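/- In the setting of the soundness identity, the matrix ς = Σ_μ π(μ) Σ_{i_1,…,i_n} (⊗_j (U^{(j)}_{i_j})^*) N_{μ;i_1…i_n} (⊗_j (U^{(j)}_{i_j})^T) is positive semidefinite with trace equal to Π_{j=1}^n d_j; moreover, if ρ is fully separable, then ς = (Π_{j=1}^n d_j)·σ for some fully separable density matrix σ on ⊗_{j=1}^n ℂ^{d_j}. -/

import Mathlib

open Matrix BigOperators
open scoped ComplexOrder Kronecker

noncomputable section

/-- A density matrix: positive semidefinite with trace one. -/
def IsDensity {ι : Type*} [Fintype ι] (ρ : Matrix ι ι ℂ) : Prop :=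
  ρ.PosSemidef ∧ ρ.trace = 1

/-- Kronecker (tensor) product of a finite family of matrices. -/
def famKron {J : Type*} [Fintype J] {ι κ : J → Type*}
    (M : ∀ j, Matrix (ι j) (κ j) ℂ) : Matrix (∀ j, ι j) (∀ j, κ j) ℂ :=
  fun a b => ∏ j, M j (a j) (b j)

/-- The maximally entangled state `Φ₊ = (1/d) Σ_{j,k} |jj⟩⟨kk|` on `ℂ^d ⊗ ℂ^d`. -/
def maxEnt (d : ℕ) : Matrix (Fin d × Fin d) (Fin d × Fin d) ℂ :=
  fun p q => if p.1 = p.2 ∧ q.1 = q.2 then (d : ℂ)⁻¹ else 0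

/-- The generalized Bell projector `(I ⊗ U) Φ₊ (I ⊗ U)†`, acting on the pair
(ancilla A', party A), ancilla first. -/
def bellProj {d : ℕ} (U : Matrix (Fin d) (Fin d) ℂ) :
    Matrix (Fin d × Fin d) (Fin d × Fin d) ℂ :=
  ((1 : Matrix (Fin d) (Fin d) ℂ) ⊗ₖ U) * maxEnt d *
    ((1 : Matrix (Fin d) (Fin d) ℂ) ⊗ₖ U)ᴴ

/-- The state on `⊗_j (A'_j ⊗ A_j)` obtained by placing `ρ` on the `A` parts (second
components) and `⊗_j ω_j` on the ancilla `A'` parts (first components). -/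
def assemble {n : ℕ} {d : Fin n → ℕ}
    (ρ : Matrix (∀ j, Fin (d j)) (∀ j, Fin (d j)) ℂ)
    (ω : ∀ j, Matrix (Fin (d j)) (Fin (d j)) ℂ) :
    Matrix (∀ j, Fin (d j) × Fin (d j)) (∀ j, Fin (d j) × Fin (d j)) ℂ :=
  fun p q => (∏ j, ω j (p j).1 (q j).1) * ρ (fun j => (p j).2) (fun j => (q j).2)

/-- Partial trace over all the `A` parts (the second components of the pairs). -/
def ptraceA {n : ℕ} {d : Fin n → ℕ}
    (M : Matrix (∀ j, Fin (d j) × Fin (d j)) (∀ j, Fin (d j) × Fin (d j)) ℂ) :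
    Matrix (∀ j, Fin (d j)) (∀ j, Fin (d j)) ℂ :=
  fun a' b' => ∑ a : ∀ j, Fin (d j), M (fun j => (a' j, a j)) (fun j => (b' j, a j))

/-- `N_{μ;i}`: the matrix on the ancilla (`A'`) parts obtained by partially tracing out
all `A` parts of `(⊗_j Ξ_{μ,i_j}) · (ρ on A, identity on A')`. -/
def NEve {n M : ℕ} {d : Fin n → ℕ}
    (Ξ : Fin M → ∀ j, Fin ((d j) ^ 2) →
      Matrix (Fin (d j) × Fin (d j)) (Fin (d j) × Fin (d j)) ℂ)
    (ρ : Matrix (∀ j, Fin (d j)) (∀ j, Fin (d j)) ℂ)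
    (μ : Fin M) (i : ∀ j, Fin ((d j) ^ 2)) :
    Matrix (∀ j, Fin (d j)) (∀ j, Fin (d j)) ℂ :=
  ptraceA (famKron (fun j => Ξ μ j (i j)) *
    assemble ρ (fun j => (1 : Matrix (Fin (d j)) (Fin (d j)) ℂ)))

/-- The effective state
`ς = Σ_μ π(μ) Σ_i (⊗_j U_{i_j}^*) N_{μ;i} (⊗_j U_{i_j}ᵀ)` produced by Eve. -/
def sigmaEve {n M : ℕ} {d : Fin n → ℕ} (π : Fin M → ℝ)
    (Ξ : Fin M → ∀ j, Fin ((d j) ^ 2) →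
      Matrix (Fin (d j) × Fin (d j)) (Fin (d j) × Fin (d j)) ℂ)
    (U : ∀ j, Fin ((d j) ^ 2) → Matrix (Fin (d j)) (Fin (d j)) ℂ)
    (ρ : Matrix (∀ j, Fin (d j)) (∀ j, Fin (d j)) ℂ) :
    Matrix (∀ j, Fin (d j)) (∀ j, Fin (d j)) ℂ :=
  ∑ μ, (π μ : ℂ) • ∑ i : ∀ j, Fin ((d j) ^ 2),
    famKron (fun j => ((U j (i j))ᵀ)ᴴ) * NEve Ξ ρ μ i *
      famKron (fun j => (U j (i j))ᵀ)

/-- Full separability of an `n`-partite state. -/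
def FullySeparable {n : ℕ} {d : Fin n → ℕ}
    (ρ : Matrix (∀ j, Fin (d j)) (∀ j, Fin (d j)) ℂ) : Prop :=
  ∃ (M : ℕ) (w : Fin M → ℝ)
    (σ : Fin M → ∀ j, Matrix (Fin (d j)) (Fin (d j)) ℂ),
    (∀ m, 0 ≤ w m) ∧ (∑ m, w m = 1) ∧
    (∀ m j, IsDensity (σ m j)) ∧
    ρ = ∑ m, (w m : ℂ) • famKron (σ m)

open scoped MatrixOrder in
theorem Matrix.PosSemidef.exists_eq_conjTranspose_mul_self {m : Type*} [Fintype m]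
    {A : Matrix m m ℂ} (hA : A.PosSemidef) : ∃ B : Matrix m m ℂ, A = Bᴴ * B := by
  classical
  exact CStarAlgebra.nonneg_iff_eq_star_mul_self.mp hA.nonneg

section FamKron

variable {J : Type*} [Fintype J] {ι κ τ : J → Type*}

theorem famKron_mul_famKron [DecidableEq J] [∀ j, Fintype (κ j)]
    (A : ∀ j, Matrix (ι j) (κ j) ℂ) (B : ∀ j, Matrix (κ j) (τ j) ℂ) :
    famKron A * famKron B = famKron (fun j => A j * B j) := by
  ext a b
  simp only [famKron, Matrix.mul_apply, Fintype.prod_sum, Finset.prod_mul_distrib]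

theorem famKron_conjTranspose (A : ∀ j, Matrix (ι j) (κ j) ℂ) :
    (famKron A)ᴴ = famKron (fun j => (A j)ᴴ) := by
  ext a b
  simp [famKron]

theorem famKron_one [∀ j, DecidableEq (ι j)] :
    famKron (fun j => (1 : Matrix (ι j) (ι j) ℂ)) = 1 := by
  ext a b
  simp only [famKron, one_apply, Finset.prod_ite_zero, Finset.prod_const_one, Finset.mem_univ,
    true_imp_iff, funext_iff]

theorem famKron_sum [DecidableEq J] {I : J → Type*} [∀ j, Fintype (I j)]
    (A : ∀ j, I j → Matrix (ι j) (κ j) ℂ) :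
    ∑ i : ∀ j, I j, famKron (fun j => A j (i j)) = famKron (fun j => ∑ i, A j i) := by
  ext a b
  simp only [famKron, Matrix.sum_apply, Fintype.prod_sum]

theorem famKron_smul (c : J → ℂ) (A : ∀ j, Matrix (ι j) (κ j) ℂ) :
    famKron (fun j => c j • A j) = (∏ j, c j) • famKron A := by
  ext a b
  simp [famKron, Finset.prod_mul_distrib]

theorem famKron_posSemidef [∀ j, Fintype (ι j)] {A : ∀ j, Matrix (ι j) (ι j) ℂ}
    (hA : ∀ j, (A j).PosSemidef) : (famKron A).PosSemidef := by
  classical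
  choose B hB using fun j => (hA j).exists_eq_conjTranspose_mul_self
  obtain rfl : A = fun j => (B j)ᴴ * B j := funext hB
  rw [← famKron_mul_famKron, ← famKron_conjTranspose]
  exact posSemidef_conjTranspose_mul_self _

end FamKron

/-- The partial trace over `β` of `K (1 ⊗ ρ)`. -/
def reducedEffect {α β : Type*} [Fintype β] (K : Matrix (α × β) (α × β) ℂ) (ρ : Matrix β β ℂ) :
    Matrix α α ℂ :=
  fun a b => ∑ x, ∑ y, K (a, x) (b, y) * ρ y x

/-- The state obtained from the effects `K i` on `ρ` after applying the corrections `V i`. -/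
def correctedState {ι α β : Type*} [Fintype ι] [Fintype α] [Fintype β] (V : ι → Matrix α α ℂ)
    (K : ι → Matrix (α × β) (α × β) ℂ) (ρ : Matrix β β ℂ) : Matrix α α ℂ :=
  ∑ i, V i * reducedEffect (K i) ρ * (V i)ᴴ

section Effect

variable {ι α β : Type*} [Fintype ι] [Fintype β]

theorem reducedEffect_posSemidef [Fintype α] {K : Matrix (α × β) (α × β) ℂ} {ρ : Matrix β β ℂ}
    (hK : K.PosSemidef) (hρ : ρ.PosSemidef) : (reducedEffect K ρ).PosSemidef := by
  classical
  obtain ⟨B, rfl⟩ := hρ.exists_eq_conjTranspose_mul_self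
  have key : reducedEffect K (Bᴴ * B) =
      ∑ k, (of fun a (p : α × β) => if a = p.1 then B k p.2 else 0) * K *
        (of fun a (p : α × β) => if a = p.1 then B k p.2 else 0)ᴴ := by
    ext a b
    simp only [reducedEffect, Matrix.sum_apply, Matrix.mul_apply, conjTranspose_apply, of_apply,
      Fintype.sum_prod_type, ite_mul, zero_mul, apply_ite star, star_zero, mul_ite, mul_zero,
      Finset.sum_ite_irrel, Finset.sum_const_zero, Finset.sum_ite_eq, Finset.mem_univ, if_true,
      Finset.mul_sum, Finset.sum_mul]
    rw [Finset.sum_comm, Finset.sum_congr rfl fun _ _ => Finset.sum_comm, Finset.sum_comm]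
    refine Finset.sum_congr rfl fun k _ => Finset.sum_congr rfl fun y _ =>
      Finset.sum_congr rfl fun x _ => ?_
    ring
  rw [key]
  exact posSemidef_sum _ fun k _ => hK.mul_mul_conjTranspose_same _

theorem sum_reducedEffect (K : ι → Matrix (α × β) (α × β) ℂ) (ρ : Matrix β β ℂ) :
    ∑ i, reducedEffect (K i) ρ = reducedEffect (∑ i, K i) ρ := by
  ext a b
  simp only [reducedEffect, Matrix.sum_apply, Finset.sum_mul]
  rw [Finset.sum_comm]
  exact Finset.sum_congr rfl fun _ _ => Finset.sum_comm

theorem reducedEffect_sum_smul (K : Matrix (α × β) (α × β) ℂ) (w : ι → ℂ)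
    (ρ : ι → Matrix β β ℂ) :
    reducedEffect K (∑ m, w m • ρ m) = ∑ m, w m • reducedEffect K (ρ m) := by
  ext a b
  simp only [reducedEffect, Matrix.sum_apply, Matrix.smul_apply, smul_eq_mul, Finset.mul_sum]
  rw [Finset.sum_comm, Finset.sum_congr rfl fun _ _ => Finset.sum_comm, Finset.sum_comm]
  refine Finset.sum_congr rfl fun m _ => ?_
  rw [Finset.sum_comm]
  refine Finset.sum_congr rfl fun y _ => Finset.sum_congr rfl fun x _ => ?_
  ring

variable [Fintype α]

theorem trace_reducedEffect_one [DecidableEq α] [DecidableEq β] (ρ : Matrix β β ℂ) :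
    (reducedEffect (1 : Matrix (α × β) (α × β) ℂ) ρ).trace = Fintype.card α * ρ.trace := by
  simp [reducedEffect, trace, one_apply]

theorem correctedState_posSemidef (V : ι → Matrix α α ℂ) {K : ι → Matrix (α × β) (α × β) ℂ}
    {ρ : Matrix β β ℂ} (hK : ∀ i, (K i).PosSemidef) (hρ : ρ.PosSemidef) :
    (correctedState V K ρ).PosSemidef :=
  posSemidef_sum _ fun i _ =>
    (reducedEffect_posSemidef (hK i) hρ).mul_mul_conjTranspose_same _

theorem trace_correctedState [DecidableEq α] [DecidableEq β] {V : ι → Matrix α α ℂ}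
    {K : ι → Matrix (α × β) (α × β) ℂ} (hV : ∀ i, (V i)ᴴ * V i = 1) (hK : ∑ i, K i = 1)
    (ρ : Matrix β β ℂ) : (correctedState V K ρ).trace = Fintype.card α * ρ.trace := by
  rw [← trace_reducedEffect_one, ← hK, ← sum_reducedEffect, correctedState, trace_sum, trace_sum]
  refine Finset.sum_congr rfl fun i _ => ?_
  rw [trace_mul_comm, ← Matrix.mul_assoc, hV, Matrix.one_mul]

theorem correctedState_sum_smul {μ : Type*} [Fintype μ] (V : ι → Matrix α α ℂ)
    (K : ι → Matrix (α × β) (α × β) ℂ) (w : μ → ℂ) (ρ : μ → Matrix β β ℂ) :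
    correctedState V K (∑ m, w m • ρ m) = ∑ m, w m • correctedState V K (ρ m) := by
  simp only [correctedState, reducedEffect_sum_smul, Finset.mul_sum, Finset.sum_mul,
    Finset.smul_sum, Matrix.mul_smul, Matrix.smul_mul]
  exact Finset.sum_comm

end Effect

section FamEffect

variable {J : Type*} [Fintype J] {α β : J → Type*}

/-- The tensor product of bipartite matrices, regrouped so that all first factors precede all
second factors. -/
def famKronProd (K : ∀ j, Matrix (α j × β j) (α j × β j) ℂ) :
    Matrix ((∀ j, α j) × ∀ j, β j) ((∀ j, α j) × ∀ j, β j) ℂ :=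
  (famKron K).submatrix (fun p j => (p.1 j, p.2 j)) fun p j => (p.1 j, p.2 j)

theorem famKronProd_one [∀ j, DecidableEq (α j)] [∀ j, DecidableEq (β j)] :
    famKronProd (fun j => (1 : Matrix (α j × β j) (α j × β j) ℂ)) = 1 := by
  rw [famKronProd, famKron_one]
  refine submatrix_one _ fun p q h => ?_
  simp only [funext_iff, Prod.mk.injEq] at h
  exact Prod.ext (funext fun j => (h j).1) (funext fun j => (h j).2)

theorem famKronProd_sum [DecidableEq J] {I : J → Type*} [∀ j, Fintype (I j)]
    (K : ∀ j, I j → Matrix (α j × β j) (α j × β j) ℂ) :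
    ∑ i : ∀ j, I j, famKronProd (fun j => K j (i j)) = famKronProd (fun j => ∑ i, K j i) := by
  rw [famKronProd, ← famKron_sum]
  ext p q
  simp [famKronProd, Matrix.sum_apply]

theorem reducedEffect_famKron [DecidableEq J] [∀ j, Fintype (β j)]
    (K : ∀ j, Matrix (α j × β j) (α j × β j) ℂ)
    (ρ : ∀ j, Matrix (β j) (β j) ℂ) :
    reducedEffect (famKronProd K) (famKron ρ) = famKron (fun j => reducedEffect (K j) (ρ j)) := by
  ext a b
  simp only [reducedEffect, famKronProd, famKron, submatrix_apply, Fintype.prod_sum,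
    Finset.prod_mul_distrib]

variable [∀ j, Fintype (α j)] [∀ j, Fintype (β j)]

theorem famKronProd_posSemidef {K : ∀ j, Matrix (α j × β j) (α j × β j) ℂ}
    (hK : ∀ j, (K j).PosSemidef) : (famKronProd K).PosSemidef :=
  (famKron_posSemidef hK).submatrix _

theorem correctedState_famKron [DecidableEq J] {I : J → Type*} [∀ j, Fintype (I j)]
    (V : ∀ j, I j → Matrix (α j) (α j) ℂ) (K : ∀ j, I j → Matrix (α j × β j) (α j × β j) ℂ)
    (ρ : ∀ j, Matrix (β j) (β j) ℂ) :
    correctedState (fun i : ∀ j, I j => famKron (fun j => V j (i j)))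
        (fun i => famKronProd (fun j => K j (i j))) (famKron ρ) =
      famKron (fun j => correctedState (V j) (K j) (ρ j)) := by
  simp only [correctedState, reducedEffect_famKron, famKron_conjTranspose, famKron_mul_famKron]
  exact famKron_sum fun j i => V j i * reducedEffect (K j i) (ρ j) * (V j i)ᴴ

end FamEffect

theorem NEve_eq_reducedEffect {n M : ℕ} {d : Fin n → ℕ}
    (Ξ : Fin M → ∀ j, Fin ((d j) ^ 2) →
      Matrix (Fin (d j) × Fin (d j)) (Fin (d j) × Fin (d j)) ℂ)
    (ρ : Matrix (∀ j, Fin (d j)) (∀ j, Fin (d j)) ℂ) (μ : Fin M) (i : ∀ j, Fin ((d j) ^ 2)) :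
    NEve Ξ ρ μ i = reducedEffect (famKronProd fun j => Ξ μ j (i j)) ρ := by
  ext a b
  simp only [NEve, ptraceA, reducedEffect, Matrix.mul_apply, assemble, famKronProd, submatrix_apply]
  refine Finset.sum_congr rfl fun x _ => ?_
  rw [← (Equiv.arrowProdEquivProdArrow _ (fun j => Fin (d j)) fun j => Fin (d j)).symm.sum_comp,
    Fintype.sum_prod_type, Finset.sum_eq_single b]
  · refine Finset.sum_congr rfl fun y _ => ?_
    change _ * ((∏ j, (1 : Matrix (Fin (d j)) (Fin (d j)) ℂ) (b j) (b j)) * ρ y x) = _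
    simp only [one_apply_eq, Finset.prod_const_one, one_mul]
    rfl
  · intro c _ hc
    obtain ⟨j, hj⟩ := Function.ne_iff.1 hc
    refine Finset.sum_eq_zero fun y _ => ?_
    rw [Finset.prod_eq_zero (Finset.mem_univ j) (by simp [hj]), zero_mul, mul_zero]
  · simp

theorem sigmaEve_eq_sum_correctedState {n M : ℕ} {d : Fin n → ℕ} (π : Fin M → ℝ)
    (Ξ : Fin M → ∀ j, Fin ((d j) ^ 2) →
      Matrix (Fin (d j) × Fin (d j)) (Fin (d j) × Fin (d j)) ℂ)
    (U : ∀ j, Fin ((d j) ^ 2) → Matrix (Fin (d j)) (Fin (d j)) ℂ)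
    (ρ : Matrix (∀ j, Fin (d j)) (∀ j, Fin (d j)) ℂ) :
    sigmaEve π Ξ U ρ = ∑ μ, (π μ : ℂ) •
      correctedState (fun i : ∀ j, Fin ((d j) ^ 2) => famKron fun j => ((U j (i j))ᵀ)ᴴ)
        (fun i => famKronProd fun j => Ξ μ j (i j)) ρ := by
  simp only [sigmaEve, correctedState, NEve_eq_reducedEffect, famKron_conjTranspose,
    conjTranspose_conjTranspose]

theorem transpose_mul_conjTranspose_eq_one {m : Type*} [Fintype m] [DecidableEq m]
    {U : Matrix m m ℂ} (hU : Uᴴ * U = 1) : Uᵀ * (Uᵀ)ᴴ = 1 := by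
  rw [show (Uᵀ)ᴴ = (Uᴴ)ᵀ from rfl, ← transpose_mul, hU, transpose_one]


/-- In the setting of the soundness identity, the effective state `ς` is positive
semidefinite with trace `Π_j d_j`; moreover, if `ρ` is fully separable then
`ς = (Π_j d_j) · σ` for some fully separable density matrix `σ`. -/
theorem sigmaEve_psd_trace_separable
    {n M : ℕ} (d : Fin n → ℕ)
    (U : ∀ j, Fin ((d j) ^ 2) → Matrix (Fin (d j)) (Fin (d j)) ℂ)
    (hU : ∀ j i, (U j i)ᴴ * U j i = 1)
    (horth : ∀ j i i', ((U j i)ᴴ * U j i').trace = if i = i' then (d j : ℂ) else 0)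
    (ρ : Matrix (∀ j, Fin (d j)) (∀ j, Fin (d j)) ℂ) (hρ : IsDensity ρ)
    (π : Fin M → ℝ) (hπ0 : ∀ μ, 0 ≤ π μ) (hπ1 : ∑ μ, π μ = 1)
    (Ξ : Fin M → ∀ j, Fin ((d j) ^ 2) →
      Matrix (Fin (d j) × Fin (d j)) (Fin (d j) × Fin (d j)) ℂ)
    (hΞpos : ∀ μ j i, (Ξ μ j i).PosSemidef)
    (hΞsum : ∀ μ j, ∑ i, Ξ μ j i = 1) :
    (sigmaEve π Ξ U ρ).PosSemidef ∧
    (sigmaEve π Ξ U ρ).trace = ∏ j, (d j : ℂ) ∧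
    (FullySeparable ρ →
      ∃ σ : Matrix (∀ j, Fin (d j)) (∀ j, Fin (d j)) ℂ,
        FullySeparable σ ∧ IsDensity σ ∧
        sigmaEve π Ξ U ρ = (∏ j, (d j : ℂ)) • σ) := by
  have hV (j i) : (((U j i)ᵀ)ᴴ)ᴴ * ((U j i)ᵀ)ᴴ = 1 := by
    rw [conjTranspose_conjTranspose, transpose_mul_conjTranspose_eq_one (hU j i)]
  have hVfam (i : ∀ j, Fin ((d j) ^ 2)) :
      (famKron fun j => ((U j (i j))ᵀ)ᴴ)ᴴ * (famKron fun j => ((U j (i j))ᵀ)ᴴ) = 1 := by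
    simp only [famKron_conjTranspose, famKron_mul_famKron, hV, famKron_one]
  have hpsd : (sigmaEve π Ξ U ρ).PosSemidef := by
    rw [sigmaEve_eq_sum_correctedState]
    refine posSemidef_sum _ fun μ _ => PosSemidef.smul ?_ (Complex.zero_le_real.2 (hπ0 μ))
    exact correctedState_posSemidef _
      (fun i => famKronProd_posSemidef fun j => hΞpos μ j (i j)) hρ.1
  have htrace : (sigmaEve π Ξ U ρ).trace = ∏ j, (d j : ℂ) := by
    have hsum (μ) : ∑ i : ∀ j, Fin ((d j) ^ 2), famKronProd (fun j => Ξ μ j (i j)) = 1 := by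
      rw [famKronProd_sum]
      simp only [hΞsum, famKronProd_one]
    simp only [sigmaEve_eq_sum_correctedState, trace_sum, trace_smul,
      trace_correctedState hVfam (hsum _), hρ.2, Fintype.card_pi, Fintype.card_fin]
    rw [← Finset.sum_smul, ← Complex.ofReal_sum, hπ1]
    simp
  have hd (j) : (d j : ℂ) ≠ 0 := by
    have : Nonempty (∀ j, Fin (d j)) := by
      by_contra h
      rw [not_nonempty_iff] at h
      simpa [trace] using hρ.2
    have := (Classical.arbitrary (∀ j, Fin (d j)) j).pos
    exact_mod_cast this.ne'
  have hinv (k : ℕ) : (0 : ℂ) ≤ (k : ℂ)⁻¹ := by simp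
  have hD : ∏ j, (d j : ℂ) ≠ 0 := Finset.prod_ne_zero_iff.2 fun j _ => hd j
  refine ⟨hpsd, htrace, ?_⟩
  rintro ⟨L, w, τ, hw0, hw1, hτ, rfl⟩
  refine ⟨(∏ j, (d j : ℂ))⁻¹ • sigmaEve π Ξ U _, ?_,
    ⟨hpsd.smul ?_, by rw [trace_smul, htrace, smul_eq_mul, inv_mul_cancel₀ hD]⟩,
    by rw [smul_smul, mul_inv_cancel₀ hD, one_smul]⟩
  · refine ⟨M * L, fun k => π (finProdFinEquiv.symm k).1 * w (finProdFinEquiv.symm k).2,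
      fun k j => (d j : ℂ)⁻¹ • correctedState (fun i => ((U j i)ᵀ)ᴴ)
        (Ξ (finProdFinEquiv.symm k).1 j) (τ (finProdFinEquiv.symm k).2 j),
      fun k => mul_nonneg (hπ0 _) (hw0 _), ?_, fun k j => ⟨?_, ?_⟩, ?_⟩
    · rw [finProdFinEquiv.symm.sum_comp (fun p : Fin M × Fin L => π p.1 * w p.2),
        Fintype.sum_prod_type, ← Fintype.sum_mul_sum, hπ1, hw1, one_mul]
    · exact (correctedState_posSemidef _ (hΞpos _ j) (hτ _ j).1).smul (hinv _)
    · rw [trace_smul, trace_correctedState (hV j) (hΞsum _ j), (hτ _ j).2, Fintype.card_fin,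
        mul_one, smul_eq_mul, inv_mul_cancel₀ (hd j)]
    · rw [finProdFinEquiv.symm.sum_comp (fun p : Fin M × Fin L => ((π p.1 * w p.2 : ℝ) : ℂ) •
        famKron fun j => (d j : ℂ)⁻¹ • correctedState (fun i => ((U j i)ᵀ)ᴴ) (Ξ p.1 j) (τ p.2 j)),
        Fintype.sum_prod_type, sigmaEve_eq_sum_correctedState, Finset.smul_sum]
      refine Finset.sum_congr rfl fun μ _ => ?_
      rw [correctedState_sum_smul, Finset.smul_sum, Finset.smul_sum]
      refine Finset.sum_congr rfl fun m _ => ?_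
      rw [famKron_smul, Finset.prod_inv_distrib, correctedState_famKron (fun j i => ((U j i)ᵀ)ᴴ),
        smul_smul, smul_smul, smul_smul]
      congr 1
      push_cast
      ring
  · rw [← Nat.cast_prod]
    exact hinv _
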